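/- Let G be a group admitting an epimorphism φ : G → ℤ whose kernel is a free group F. Then the intersection of the subgroups G ⊇ F ⊇ F^{(1)} ⊇ F^{(2)} ⊇ ⋯ of the derived series of F is trivial, each F^{(n)} is a normal subgroup of G, and each quotient G/F^{(n)} is a torsion-free solvable group; hence G is residually torsion-free solvable. -/

import Mathlib

universe u

section helpers

open Classical in
/-- Permutation of `Q × ℤ` counting signed passages through the edge `(q0, a0)`. -/
noncomputable def edgePerm {α Q : Type*} [Group Q] (x : α → Q) (a0 : α) (q0 : Q) (a : α) :
    Equiv.Perm (Q × ℤ) where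
  toFun p := (x a * p.1, p.2 + if a = a0 ∧ p.1 = q0 then 1 else 0)
  invFun p := ((x a)⁻¹ * p.1, p.2 - if a = a0 ∧ (x a)⁻¹ * p.1 = q0 then 1 else 0)
  left_inv p := by ext <;> simp
  right_inv p := by ext <;> simp

theorem edgePerm_translation {α Q : Type*} [Group Q] (x : α → Q) (a0 : α) (q0 : Q)
    (w : FreeGroup α) : ∃ c : Q → ℤ, ∀ p : Q × ℤ,
      FreeGroup.lift (edgePerm x a0 q0) w p = (FreeGroup.lift x w * p.1, p.2 + c p.1) := by
  classical
  induction w using FreeGroup.induction_on with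
  | C1 => exact ⟨0, fun p => by simp⟩
  | of a =>
    exact ⟨fun q => if a = a0 ∧ q = q0 then 1 else 0, fun p => by simp [edgePerm]⟩
  | inv_of a _ =>
    refine ⟨fun q => - if a = a0 ∧ (x a)⁻¹ * q = q0 then 1 else 0, fun p => ?_⟩
    simp only [map_inv, FreeGroup.lift_apply_of]
    change (edgePerm x a0 q0 a).symm p = _
    simp [edgePerm, sub_eq_add_neg]
  | mul u v hu hv =>
    obtain ⟨c, hc⟩ := hu
    obtain ⟨d, hd⟩ := hv
    refine ⟨fun q => d q + c (FreeGroup.lift x v * q), fun p => ?_⟩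
    rw [map_mul, Equiv.Perm.mul_apply, hd, hc]
    simp [mul_assoc, add_assoc]

theorem commutator_ker_le {α Q : Type*} [Group Q] (x : α → Q) (a0 : α) (q0 : Q) :
    ⁅(FreeGroup.lift x).ker, (FreeGroup.lift x).ker⁆ ≤
      (FreeGroup.lift (edgePerm x a0 q0)).ker := by
  rw [Subgroup.commutator_le]
  intro u hu v hv
  rw [MonoidHom.mem_ker] at *
  rw [map_commutatorElement, commutatorElement_eq_one_iff_mul_comm]
  obtain ⟨c, hc⟩ := edgePerm_translation x a0 q0 u
  obtain ⟨d, hd⟩ := edgePerm_translation x a0 q0 v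
  ext p
  · simp [hc, hd, hu, hv]
  · simp only [Equiv.Perm.mul_apply, hc, hd, hu, hv, one_mul]
    ring

/-- If no later letter crosses the edge in the direction `!b`, the counter has sign `b`. -/
theorem count_sign {α Q : Type*} [Group Q] (x : α → Q) (a0 : α) (q0 : Q) (b : Bool)
    (q1 : Q) (hq1 : q1 = if b then q0 else x a0 * q0) (L : List (α × Bool))
    (h : ∀ L1 L2, L = L1 ++ (a0, !b) :: L2 →
      FreeGroup.lift x (FreeGroup.mk (L2 ++ [(a0, b)])) * q1 ≠
        if b then x a0 * q0 else q0) :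
    0 < (if b then 1 else -1) *
      (FreeGroup.lift (edgePerm x a0 q0) (FreeGroup.mk (L ++ [(a0, b)])) (q1, 0)).2 := by
  classical
  induction L with
  | nil =>
    cases b
    · simp only [List.nil_append, FreeGroup.lift_mk, List.map_cons, List.map_nil,
        List.prod_cons, List.prod_nil, mul_one, cond_false]
      change 0 < _ * ((edgePerm x a0 q0 a0).symm (q1, 0)).2
      simp [edgePerm, hq1]
    · simp [edgePerm, hq1]
  | cons l L ih =>
    obtain ⟨a, bb⟩ := l
    have ihh := ih (fun L1 L2 hL => h ((a, bb) :: L1) L2 (by simp [hL]))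
    have h0 := h [] L
    obtain ⟨c, hc⟩ := edgePerm_translation x a0 q0 (FreeGroup.mk (L ++ [(a0, b)]))
    have e : FreeGroup.mk ((a, bb) :: L ++ [(a0, b)]) =
        FreeGroup.mk [(a, bb)] * FreeGroup.mk (L ++ [(a0, b)]) := by
      simp [FreeGroup.mul_mk]
    rw [e, map_mul, Equiv.Perm.mul_apply, hc]
    rw [hc] at ihh
    generalize FreeGroup.lift x (FreeGroup.mk (L ++ [(a0, b)])) = g at *
    simp only at *
    cases bb
    · have : FreeGroup.lift (edgePerm x a0 q0) (FreeGroup.mk [(a, false)])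
          = (edgePerm x a0 q0 a).symm := by
        simp [FreeGroup.lift_mk]; rfl
      rw [this]
      cases b
      · simp [edgePerm] at *
        split_ifs <;> linarith
      · simp [edgePerm] at *
        split_ifs with hh
        · exact absurd (inv_mul_eq_iff_eq_mul.mp (hh.1 ▸ hh.2)) (h0 hh.1)
        · linarith
    · have : FreeGroup.lift (edgePerm x a0 q0) (FreeGroup.mk [(a, true)])
          = (edgePerm x a0 q0 a) := by
        simp [FreeGroup.lift_mk]
      rw [this]
      cases b
      · simp [edgePerm] at *
        split_ifs with hh
        · exact absurd hh.2 (h0 hh.1)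
        · linarith
      · simp [edgePerm] at *
        split_ifs <;> linarith

theorem reduced_not_mem {α : Type*} (n : ℕ) : ∀ L : List (α × Bool), FreeGroup.IsReduced L →
    L ≠ [] → L.length ≤ n → FreeGroup.mk L ∉ derivedSeries (FreeGroup α) n := by
  induction n with
  | zero => intro L _ h h'; simp at h'; exact absurd h' h
  | succ k ih =>
    intro L hL hne hlen hmem
    obtain ⟨Lp, ⟨a0, b⟩, rfl⟩ := List.eq_nil_or_concat L |>.resolve_left hne
    simp only [List.concat_eq_append] at hL hne hlen hmem
    set D := derivedSeries (FreeGroup α) k with hD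
    let x : α → FreeGroup α ⧸ D := fun a => QuotientGroup.mk' D (FreeGroup.of a)
    have hx : FreeGroup.lift x = QuotientGroup.mk' D := by
      ext a; simp [x]
    have hker : (FreeGroup.lift x).ker = D := by rw [hx, QuotientGroup.ker_mk']
    have key : ∀ q0, FreeGroup.lift (edgePerm x a0 q0) (FreeGroup.mk (Lp ++ [(a0, b)])) = 1 := by
      intro q0
      have := commutator_ker_le x a0 q0
      rw [hker] at this
      exact this hmem
    let q0 : FreeGroup α ⧸ D := if b then 1 else (x a0)⁻¹
    by_cases h : ∀ L1 L2, Lp = L1 ++ (a0, !b) :: L2 →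
      FreeGroup.lift x (FreeGroup.mk (L2 ++ [(a0, b)])) * 1 ≠
        if b then x a0 * q0 else q0
    · have := count_sign x a0 q0 b 1 (by cases b <;> simp [q0]) Lp h
      rw [key] at this
      simp at this
    · push Not at h
      obtain ⟨L1, L2, rfl, h⟩ := h
      have hmem2 : FreeGroup.lift x (FreeGroup.mk L2) = 1 := by
        rw [← FreeGroup.mul_mk, map_mul] at h
        cases b <;> simpa [q0, FreeGroup.lift_mk] using h
      rw [← MonoidHom.mem_ker, hker] at hmem2
      have hL2 : FreeGroup.IsReduced ((a0, !b) :: (L2 ++ [(a0, b)])) :=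
        hL.infix ⟨L1, [], by simp⟩
      refine ih L2 (hL2.infix ⟨[(a0, !b)], [(a0, b)], by simp⟩) ?_ ?_ hmem2
      · rintro rfl
        simp [FreeGroup.IsReduced] at hL2
      · simp at hlen; omega

theorem freeGroup_iInf_derivedSeries (α : Type*) (w : FreeGroup α)
    (h : ∀ n, w ∈ derivedSeries (FreeGroup α) n) : w = 1 := by
  classical
  by_contra hw
  refine reduced_not_mem w.toWord.length w.toWord FreeGroup.isReduced_toWord ?_ le_rfl ?_
  · simpa using hw
  · rw [FreeGroup.mk_toWord]; exact h _

theorem isFree_iInf {F : Type*} [Group F] [IsFreeGroup F] (w : F)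
    (h : ∀ n, w ∈ derivedSeries F n) : w = 1 := by
  let e := IsFreeGroup.toFreeGroup F
  have : e w = 1 := freeGroup_iInf_derivedSeries _ _ fun n =>
    map_derivedSeries_le_derivedSeries e.toMonoidHom n (Subgroup.mem_map_of_mem _ (h n))
  simpa using this

theorem isFree_root {F : Type*} [Group F] [IsFreeGroup F] (w : F) (m : ℕ) (hm : m ≠ 0)
    (h : w ^ m ∈ commutator F) : w ∈ commutator F := by
  let e := IsFreeGroup.toFreeGroup F
  let E := e.abelianizationCongr
  rw [← Abelianization.ker_of, MonoidHom.mem_ker] at *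
  apply E.injective
  have h2 := congrArg E h
  rw [map_pow, map_pow, map_one] at h2
  rw [map_one]
  let T := FreeAbelianGroup.equivFinsupp (IsFreeGroup.Generators F)
  let z : FreeAbelianGroup (IsFreeGroup.Generators F) := Additive.ofMul (E (Abelianization.of w))
  have h2z : m • z = 0 := h2
  have h3 : m • T z = 0 := by
    rw [← map_nsmul, h2z, map_zero]
  have h4 := (smul_eq_zero.mp h3).resolve_left hm
  exact (map_eq_zero_iff T T.injective).mp h4

theorem isFree_derived_root {F : Type u} [Group F] [IsFreeGroup F] (n : ℕ) (w : F) (m : ℕ)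
    (hm : m ≠ 0) (h : w ^ m ∈ derivedSeries F n) : w ∈ derivedSeries F n := by
  induction n with
  | zero => simp
  | succ n ih =>
    have hw := ih (derivedSeries_antitone F n.le_succ h)
    have hc : (commutator (derivedSeries F n)).map (derivedSeries F n).subtype
        = derivedSeries F (n + 1) := by
      rw [commutator_def, Subgroup.map_commutator, derivedSeries_succ,
        ← MonoidHom.range_eq_map, Subgroup.range_subtype]
    rw [← hc] at h ⊢
    obtain ⟨y, hy, hyw⟩ := h
    refine ⟨⟨w, hw⟩, isFree_root _ m hm ?_, rfl⟩
    have : y = (⟨w, hw⟩ : derivedSeries F n) ^ m := Subtype.ext hyw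
    exact this ▸ hy

end helpers

/-- Let `G` admit an epimorphism `φ : G → ℤ` whose kernel `F` is a free group.  Then the
terms `F⁽ⁿ⁾` of the derived series of `F` (viewed as subgroups of `G`) are normal in `G`,
their intersection is trivial, each quotient `G/F⁽ⁿ⁾` is a torsion-free solvable group,
and consequently `G` is residually torsion-free solvable. -/
theorem residually_torsionfree_solvable_of_free_kernel {G : Type u} [Group G]
    (φ : G →* Multiplicative ℤ) (hφ : Function.Surjective φ)
    [IsFreeGroup φ.ker] :
    (∀ n : ℕ, ((derivedSeries (↥φ.ker) n).map φ.ker.subtype).Normal) ∧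
    (⨅ n : ℕ, (derivedSeries (↥φ.ker) n).map φ.ker.subtype) = ⊥ ∧
    (∀ n : ℕ, ∃ (H : Type u) (_ : Group H) (ψ : G →* H),
      ψ.ker = (derivedSeries (↥φ.ker) n).map φ.ker.subtype ∧
      IsSolvable H ∧
      (∀ (h : H) (m : ℕ), m ≠ 0 → h ^ m = 1 → h = 1)) ∧
    (∀ g : G, g ≠ 1 → ∃ (H : Type u) (_ : Group H) (ψ : G →* H),
      IsSolvable H ∧ (∀ (h : H) (m : ℕ), m ≠ 0 → h ^ m = 1 → h = 1) ∧ ψ g ≠ 1) := by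
  have hN : ∀ n : ℕ, ((derivedSeries (↥φ.ker) n).map φ.ker.subtype).Normal :=
    fun n => inferInstance
  have hI : ∀ g : G, (∀ n, g ∈ (derivedSeries (↥φ.ker) n).map φ.ker.subtype) → g = 1 := by
    intro g hg
    obtain ⟨y, _, rfl⟩ := hg 0
    have : y = 1 := isFree_iInf y fun n => by
      obtain ⟨z, hz, hzy⟩ := hg n
      rwa [← Subtype.ext hzy]
    simp [this]
  have hQ : ∀ n : ℕ, ∃ (H : Type u) (_ : Group H) (ψ : G →* H),
      ψ.ker = (derivedSeries (↥φ.ker) n).map φ.ker.subtype ∧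
      IsSolvable H ∧
      (∀ (h : H) (m : ℕ), m ≠ 0 → h ^ m = 1 → h = 1) := by
    intro n
    have := hN n
    set N := (derivedSeries (↥φ.ker) n).map φ.ker.subtype with hNdef
    have hle : N ≤ φ.ker := by
      rintro _ ⟨y, _, rfl⟩; exact y.2
    refine ⟨G ⧸ N, inferInstance, QuotientGroup.mk' N, QuotientGroup.ker_mk' N, ?_, ?_⟩
    · have : Group.IsSolvable (↥φ.ker ⧸ derivedSeries (↥φ.ker) n) := by
        refine ⟨n, ?_⟩
        rw [← map_derivedSeries_eq (QuotientGroup.mk'_surjective (derivedSeries (↥φ.ker) n)),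
          Subgroup.map_eq_bot_iff, QuotientGroup.ker_mk']
      refine Group.isSolvable_of_ker_le_range
        (QuotientGroup.map (derivedSeries (↥φ.ker) n) N φ.ker.subtype
          (Subgroup.map_le_iff_le_comap.mp le_rfl))
        (QuotientGroup.lift N φ hle) ?_
      intro q hq
      obtain ⟨g, rfl⟩ := QuotientGroup.mk'_surjective N q
      exact ⟨QuotientGroup.mk' _ ⟨g, by simpa using hq⟩, rfl⟩
    · intro h m hm hh
      obtain ⟨g, rfl⟩ := QuotientGroup.mk'_surjective N h
      rw [← map_pow, ← MonoidHom.mem_ker, QuotientGroup.ker_mk'] at hh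
      rw [← MonoidHom.mem_ker, QuotientGroup.ker_mk']
      have hg : g ∈ φ.ker := by
        have h1 : φ g ^ m = 1 := by rw [← map_pow]; exact hle hh
        exact (pow_eq_one_iff.mp h1).resolve_right hm
      obtain ⟨y, hy, hyg⟩ := hh
      refine ⟨⟨g, hg⟩, isFree_derived_root n _ m hm ?_, rfl⟩
      have : y = (⟨g, hg⟩ : φ.ker) ^ m := Subtype.ext hyg
      exact this ▸ hy
  refine ⟨hN, ?_, hQ, ?_⟩
  · rw [eq_bot_iff]
    intro g hg
    exact hI g (by simpa only [Subgroup.mem_iInf] using hg)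
  · intro g hg
    by_contra hcon
    refine hg (hI g fun n => ?_)
    obtain ⟨H, i, ψ, hk, hs, ht⟩ := hQ n
    rw [← hk, MonoidHom.mem_ker]
    by_contra hne
    exact hcon ⟨H, i, ψ, hs, ht, hne⟩
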